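/- The function k ↦ 1/(1 − Ĵ(k)) is Lebesgue-integrable on the cube [-π,π]³; consequently the integral defining G(v) is finite for every v ∈ ℤ³. -/

import Mathlib

open MeasureTheory Real Filter

noncomputable section

abbrev Site : Type := Fin 3 → ℤ

/-- Nearest-neighbor adjacency on `ℤ³`. -/
def adj (k l : Site) : Prop := (∑ i, |k i - l i|) = 1

instance (k l : Site) : Decidable (adj k l) := by unfold adj; infer_instance

/-- The interior `Λ_L° = ((-L,L) ∩ ℤ)³`. -/
def interF (L : ℕ) : Finset Site := Finset.Icc (fun _ => -(L : ℤ) + 1) (fun _ => (L : ℤ) - 1)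

/-- The box `Λ_L = ([-L,L] ∩ ℤ)³`. -/
def lamF (L : ℕ) : Finset Site := Finset.Icc (fun _ => -(L : ℤ)) (fun _ => (L : ℤ))

/-- Configurations of angles on the interior of `Λ_L`. -/
abbrev Cfg (L : ℕ) : Type := ↥(interF L) → ℝ

/-- The cube `[0,2π]^{Λ_L°}`. -/
def cube (L : ℕ) : Set (Cfg L) := Set.univ.pi fun _ => Set.Icc 0 (2 * π)

/-- Evaluation of a configuration at a site (`0` outside the interior). -/
def val (L : ℕ) (θ : Cfg L) (x : Site) : ℝ := if h : x ∈ interF L then θ ⟨x, h⟩ else 0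

/-- Free-boundary energy `(β/6) Σ_{k,l ∈ Λ_L°, |k-l|=1} cos(θ_k - θ_l)`. -/
def energy0 (L : ℕ) (β : ℝ) (θ : Cfg L) : ℝ :=
  β / 6 * ∑ k : ↥(interF L), ∑ l : ↥(interF L),
    if adj k.1 l.1 then Real.cos (θ k - θ l) else 0

/-- `N_∂(k)`, the number of boundary neighbors of `k`. -/
def nBd (L : ℕ) (k : Site) : ℕ := ((lamF L \ interF L).filter fun l => adj k l).card

/-- Plus-boundary energy. -/
def energyP (L : ℕ) (β : ℝ) (θ : Cfg L) : ℝ :=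
  energy0 L β θ + β / 3 * ∑ k : ↥(interF L), (nBd L k.1 : ℝ) * Real.cos (θ k)

/-- Free-boundary expectation `⟨F⟩_{L,0,β}`. -/
def avg0 (L : ℕ) (β : ℝ) (F : Cfg L → ℝ) : ℝ :=
  (∫ θ in cube L, F θ * Real.exp (energy0 L β θ)) / ∫ θ in cube L, Real.exp (energy0 L β θ)

/-- Plus-boundary expectation `⟨F⟩_{L,+,β}`. -/
def avgP (L : ℕ) (β : ℝ) (F : Cfg L → ℝ) : ℝ :=
  (∫ θ in cube L, F θ * Real.exp (energyP L β θ)) / ∫ θ in cube L, Real.exp (energyP L β θ)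

/-- Free-boundary two-point function `⟨cos(θ_x - θ_y)⟩_{L,0,β}`. -/
def corr0 (L : ℕ) (β : ℝ) (x y : Site) : ℝ :=
  avg0 L β fun θ => Real.cos (val L θ x - val L θ y)

/-- Plus-boundary two-point function `⟨cos(θ_x - θ_y)⟩_{L,+,β}`. -/
def corrPlus (L : ℕ) (β : ℝ) (x y : Site) : ℝ :=
  avgP L β fun θ => Real.cos (val L θ x - val L θ y)

/-- Finite-volume plus-boundary magnetization at site `y`. -/
def magAt (L : ℕ) (β : ℝ) (y : Site) : ℝ := avgP L β fun θ => Real.cos (val L θ y)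

/-- The spontaneous magnetization `m*(β) = inf_{L ≥ 2} ⟨cos θ_0⟩_{L,+,β}`. -/
def mStar (β : ℝ) : ℝ := sInf {r : ℝ | ∃ L : ℕ, 2 ≤ L ∧ r = magAt L β 0}

/-- The critical inverse temperature `β_c`. -/
def critBeta : ℝ := sSup {β : ℝ | 0 < β ∧ mStar β = 0}

/-- Sup-norm on `ℤ³`. -/
def supNorm (x : Site) : ℤ := max |x 0| (max |x 1| |x 2|)

/-- Infinite-volume free-boundary two-point function
`⟨S_x·S_y⟩_{0,β} = sup_{L > max(‖x‖∞,‖y‖∞)} ⟨cos(θ_x - θ_y)⟩_{L,0,β}`. -/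
def S20 (β : ℝ) (x y : Site) : ℝ :=
  sSup {r : ℝ | ∃ L : ℕ, max (supNorm x) (supNorm y) < (L : ℤ) ∧ r = corr0 L β x y}

/-- The box `B_n = {z ∈ ℤ³ : max |z_i| ≤ n}`. -/
def Bn (n : ℕ) : Finset Site := Finset.Icc (fun _ => -(n : ℤ)) (fun _ => (n : ℤ))

/-- Fundamental domain `{-L,…,L-1}³` for the torus `T_L = (ℤ/2Lℤ)³`. -/
def torF (L : ℕ) : Finset Site := Finset.Icc (fun _ => -(L : ℤ)) (fun _ => (L : ℤ) - 1)

/-- Distance on `ℤ/2Lℤ`. -/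
def torDist (L : ℕ) (m : ℤ) : ℤ := min (m % (2 * (L : ℤ))) (2 * (L : ℤ) - m % (2 * (L : ℤ)))

/-- Graph adjacency on the torus `T_L`. -/
def adjT (L : ℕ) (k l : Site) : Prop := (∑ i, torDist L (k i - l i)) = 1

instance (L : ℕ) (k l : Site) : Decidable (adjT L k l) := by unfold adjT; infer_instance

abbrev TCfg (L : ℕ) : Type := ↥(torF L) → ℝ

def cubeT (L : ℕ) : Set (TCfg L) := Set.univ.pi fun _ => Set.Icc 0 (2 * π)

def valT (L : ℕ) (θ : TCfg L) (x : Site) : ℝ := if h : x ∈ torF L then θ ⟨x, h⟩ else 0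

/-- Periodic-boundary energy on the torus `T_L`. -/
def energyT (L : ℕ) (β : ℝ) (θ : TCfg L) : ℝ :=
  β / 6 * ∑ k : ↥(torF L), ∑ l : ↥(torF L),
    if adjT L k.1 l.1 then Real.cos (θ k - θ l) else 0

/-- Periodic-boundary expectation `⟨F⟩_{L,P,β}`. -/
def avgT (L : ℕ) (β : ℝ) (F : TCfg L → ℝ) : ℝ :=
  (∫ θ in cubeT L, F θ * Real.exp (energyT L β θ)) / ∫ θ in cubeT L, Real.exp (energyT L β θ)

/-- Periodic two-point function `⟨cos(θ_x - θ_y)⟩_{L,P,β}`. -/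
def corrT (L : ℕ) (β : ℝ) (x y : Site) : ℝ :=
  avgT L β fun θ => Real.cos (valT L θ x - valT L θ y)

/-- `Ĵ(k) = (cos k₁ + cos k₂ + cos k₃)/3`. -/
def Jhat (k : Fin 3 → ℝ) : ℝ := (Real.cos (k 0) + Real.cos (k 1) + Real.cos (k 2)) / 3

/-- The cube `[-π,π]³`. -/
def Qpi : Set (Fin 3 → ℝ) := Set.univ.pi fun _ => Set.Icc (-π) π

/-- The lattice Green-type function `G(v)`. -/
def green (v : Site) : ℝ :=
  ((2 * π) ^ 3)⁻¹ * ∫ k in Qpi, Real.cos (∑ i, k i * (v i : ℝ)) / (1 - Jhat k)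

/-- `G(x,y) := G(x-y)`. -/
def greenXY (x y : Site) : ℝ := green (x - y)

end

theorem sq_norm_le_one_sub_Jhat {k : Fin 3 → ℝ} (hk : k ∈ Qpi) :
    2 / (3 * π ^ 2) * ‖k‖ ^ 2 ≤ 1 - Jhat k := by
  have hcos : ∀ i, Real.cos (k i) ≤ 1 - 2 / π ^ 2 * k i ^ 2 := fun i =>
    Real.cos_le_one_sub_mul_cos_sq (abs_le.2 (hk i (Set.mem_univ i)))
  have hnorm : ‖k‖ ^ 2 ≤ k 0 ^ 2 + k 1 ^ 2 + k 2 ^ 2 := by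
    have : ‖k‖ ≤ √(k 0 ^ 2 + k 1 ^ 2 + k 2 ^ 2) := by
      refine (pi_norm_le_iff_of_nonneg (Real.sqrt_nonneg _)).2 fun i => Real.abs_le_sqrt ?_
      fin_cases i <;> simp <;> nlinarith [sq_nonneg (k 0), sq_nonneg (k 1), sq_nonneg (k 2)]
    exact (Real.le_sqrt (norm_nonneg k) (by positivity)).1 this
  calc 2 / (3 * π ^ 2) * ‖k‖ ^ 2
      ≤ 2 / (3 * π ^ 2) * (k 0 ^ 2 + k 1 ^ 2 + k 2 ^ 2) := by gcongr
    _ = (2 / π ^ 2 * k 0 ^ 2 + 2 / π ^ 2 * k 1 ^ 2 + 2 / π ^ 2 * k 2 ^ 2) / 3 := by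
      field_simp
    _ ≤ 1 - Jhat k := by
      unfold Jhat
      linarith [hcos 0, hcos 1, hcos 2]

theorem integrableOn_div_one_sub_Jhat {g : (Fin 3 → ℝ) → ℝ} (hg : Measurable g)
    (hg_le : ∀ k, |g k| ≤ 1) :
    IntegrableOn (fun k => g k / (1 - Jhat k)) Qpi volume := by
  have hQ : MeasurableSet Qpi := MeasurableSet.univ_pi fun _ => measurableSet_Icc
  have hmeas : Measurable fun k => g k / (1 - Jhat k) := by
    unfold Jhat
    fun_prop
  have hdecay : ∀ k, ‖Qpi.indicator (fun k => g k / (1 - Jhat k)) k‖ ≤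
      3 * π ^ 2 / 2 * ‖k‖ ^ (-2 : ℝ) := by
    intro k
    by_cases hk : k ∈ Qpi
    · rw [Set.indicator_of_mem hk, norm_div, Real.norm_eq_abs, Real.norm_eq_abs,
        Real.rpow_neg (norm_nonneg k), Real.rpow_two]
      rcases eq_or_ne k 0 with rfl | hk0
      · norm_num [Jhat]
      · have hpos : 0 < 2 / (3 * π ^ 2) * ‖k‖ ^ 2 := by
          have := norm_pos_iff.2 hk0
          positivity
        calc |g k| / |1 - Jhat k| ≤ 1 / (2 / (3 * π ^ 2) * ‖k‖ ^ 2) := by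
              gcongr
              · exact hg_le k
              · exact (sq_norm_le_one_sub_Jhat hk).trans (le_abs_self _)
          _ = 3 * π ^ 2 / 2 * (‖k‖ ^ 2)⁻¹ := by field_simp
    · rw [Set.indicator_of_notMem hk, norm_zero]
      positivity
  have hloc : LocallyIntegrable (Qpi.indicator fun k => g k / (1 - Jhat k)) volume :=
    locallyIntegrable_of_norm_le_rpow (by simp) (by norm_num) (ae_of_all _ hdecay)
      (hmeas.indicator hQ).aestronglyMeasurable
  have hcompact : IsCompact Qpi := isCompact_univ_pi fun _ => isCompact_Icc
  exact (hloc.integrableOn_isCompact hcompact).congr_fun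
    (fun _ hk => Set.indicator_of_mem hk _) hQ

/-- `k ↦ 1/(1 - Ĵ(k))` is Lebesgue-integrable on `[-π,π]³`; consequently
the integral defining `G(v)` is finite for every `v ∈ ℤ³`. -/
theorem green_integrand_integrable :
    MeasureTheory.IntegrableOn (fun k : Fin 3 → ℝ => 1 / (1 - Jhat k)) Qpi volume ∧
    ∀ v : Site, MeasureTheory.IntegrableOn
      (fun k : Fin 3 → ℝ => Real.cos (∑ i, k i * (v i : ℝ)) / (1 - Jhat k)) Qpi volume := by
  refine ⟨integrableOn_div_one_sub_Jhat measurable_const (by simp), fun v =>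
    integrableOn_div_one_sub_Jhat (by fun_prop) fun k => Real.abs_cos_le_one _⟩
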